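/- Let A ∈ ℝ^{m×n} satisfy ‖A‖_op ≤ 1, let Ψ = A Aᵀ − κ I_m, and let x ∼ N(0, I_n/κ) be a standard Gaussian scaled by 1/√κ. Let f(x) = Tr A(Ψ, diag(A x))/m where A(Ψ, Z) is an alternating product of Ψ with bounded Lipschitz functions q_i applied entrywise to Z. Then Var(f(x)) ≤ C(A)²/(κ m), where C(A) depends only on k and the sup-norms and Lipschitz constants of the q_i. In particular f, as a function of x ∈ ℝ^n, is (C(A)/√m)-Lipschitz and the bound follows from the Gaussian Poincaré inequality. -/

import Mathlib

open MeasureTheory ProbabilityTheory Matrix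

section

open Filter Topology


lemma pi_ac (n : ℕ) (v : NNReal) (hv : v ≠ 0) :
    (Measure.pi fun _ : Fin n => gaussianReal 0 v) ≪ (volume : Measure (Fin n → ℝ)) := by
  rw [volume_pi]
  induction n with
  | zero => 
    rw [Measure.pi_of_empty, Measure.pi_of_empty]
  | succ n ih =>
    have h1 := measurePreserving_piFinSuccAbove (fun _ : Fin (n+1) => gaussianReal 0 v) 0
    have h2 := measurePreserving_piFinSuccAbove (fun _ : Fin (n+1) => (volume : Measure ℝ)) 0
    have h3 := ((gaussianReal_absolutelyContinuous 0 hv).prod ih).map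
      (MeasurableEquiv.piFinSuccAbove (fun _ : Fin (n+1) => ℝ) 0).symm.measurable
    rw [h1.symm.map_eq, h2.symm.map_eq] at h3
    exact h3

lemma int_lin {n : ℕ} (v : NNReal) (l : (Fin n → ℝ) →L[ℝ] ℝ) :
    ∫ y, (l y)^2 ∂(Measure.pi fun _ : Fin n => gaussianReal 0 v)
      = v * ∑ i, (l (Pi.single i 1))^2 := by
  have hl : (l : (Fin n → ℝ) → ℝ) = ∑ i, fun y : Fin n → ℝ => (l (Pi.single i 1)) * y i := by
    ext y
    conv_lhs => rw [← Finset.univ_sum_single y]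
    rw [map_sum, Finset.sum_apply]
    refine Finset.sum_congr rfl fun i _ => ?_
    have : (Pi.single i (y i) : Fin n → ℝ) = y i • Pi.single i 1 := by
      rw [← Pi.single_smul]; simp
    rw [this, map_smul]; simp [mul_comm]
  have hc : ∫ y, l y ∂(Measure.pi fun _ : Fin n => gaussianReal 0 v) = 0 := by
    rw [hl]
    simp only [Finset.sum_apply]
    rw [integral_finsetSum]
    · refine Finset.sum_eq_zero fun i _ => ?_
      rw [integral_const_mul, integral_eval]
      simp
    · intro i _
      exact (Integrable.const_mul (integrable_eval (μ := fun _ : Fin n => gaussianReal 0 v) (i := i) (IsGaussian.integrable_id)) _)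
  have hv : Var[l; Measure.pi fun _ : Fin n => gaussianReal 0 v] = v * ∑ i, (l (Pi.single i 1))^2 := by
    rw [hl]
    rw [variance_sum_pi (X := fun i => fun t : ℝ => l (Pi.single i 1) * t)]
    · change ∑ i, Var[fun x ↦ _ * (id x); gaussianReal 0 v] = _
      simp_rw [variance_const_mul, variance_id_gaussianReal, ← hl]
      rw [Finset.mul_sum]
      exact Finset.sum_congr rfl fun i _ => mul_comm _ _
    · exact fun i => IsGaussian.memLp_two_id.const_mul _
  rw [← hv, variance_of_integral_eq_zero (by fun_prop) hc]

lemma grad_bound {n : ℕ} (g : (Fin n → ℝ) → ℝ) (K : ℝ) (hK : 0 ≤ K)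
    (hg : ∀ x y, |g x - g y| ≤ K * √(∑ i, (x i - y i)^2)) (x : Fin n → ℝ) :
    ∑ i, (fderiv ℝ g x (Pi.single i 1))^2 ≤ K^2 := by
  by_cases hd : DifferentiableAt ℝ g x
  swap
  · rw [fderiv_zero_of_not_differentiableAt hd]; simp; positivity
  have hb : ∀ w : Fin n → ℝ, |fderiv ℝ g x w| ≤ K * √(∑ i, w i ^2) := by
    intro w
    have h1 : HasDerivAt (fun t : ℝ => g (x + t • w)) (fderiv ℝ g x w) 0 := by
      have h2 : HasDerivAt (fun t : ℝ => x + t • w) w 0 := by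
        simpa using ((hasDerivAt_id (0:ℝ)).smul_const w).const_add x
      have h3 : HasFDerivAt g (fderiv ℝ g x) (x + (0:ℝ) • w) := by simpa using hd.hasFDerivAt
      exact h3.comp_hasDerivAt 0 h2
    have h4 : LipschitzWith (Real.toNNReal (K * √(∑ i, w i ^2))) (fun t : ℝ => g (x + t • w)) := by
      refine LipschitzWith.of_dist_le_mul fun s t => ?_
      rw [Real.coe_toNNReal _ (by positivity), Real.dist_eq, Real.dist_eq]
      refine (hg _ _).trans (le_of_eq ?_)
      have : ∀ i, ((x + s • w) i - (x + t • w) i)^2 = (s-t)^2 * w i ^2 := by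
        intro i; simp; ring
      simp_rw [this]
      rw [← Finset.mul_sum, Real.sqrt_mul (sq_nonneg _), Real.sqrt_sq_eq_abs]; ring
    have := h1.le_of_lipschitz h4
    rwa [Real.coe_toNNReal _ (by positivity), Real.norm_eq_abs] at this
  set l := fderiv ℝ g x
  set S := ∑ i, (l (Pi.single i 1))^2 with hS
  have hS0 : 0 ≤ S := by positivity
  have h := hb (fun i => l (Pi.single i 1))
  have e : l (fun i => l (Pi.single i 1)) = S := by
    conv_lhs => rw [← Finset.univ_sum_single (fun i => l (Pi.single i 1))]
    rw [map_sum]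
    refine Finset.sum_congr rfl fun i _ => ?_
    have : (Pi.single i (l (Pi.single i 1)) : Fin n → ℝ) = (l (Pi.single i 1)) • Pi.single i 1 := by
      rw [← Pi.single_smul]; simp
    rw [this, map_smul]; simp [sq]
  rw [e, abs_of_nonneg hS0, ← hS] at h
  have h5 : √S * √S = S := Real.mul_self_sqrt hS0
  have h6 : 0 ≤ √S := Real.sqrt_nonneg _
  have h7 : √S ≤ K := by
    by_contra hc
    push Not at hc
    nlinarith
  nlinarith

lemma gauss_pi (n : ℕ) (v : NNReal) : IsGaussian (Measure.pi fun _ : Fin n => gaussianReal 0 v) := by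
  have h := iIndepFun.hasGaussianLaw (P := Measure.pi fun _ : Fin n => gaussianReal 0 v)
    (X := fun i ω => ω i) (fun i => ⟨by
      rw [(measurePreserving_eval (fun _ : Fin n => gaussianReal 0 v) i).map_eq]; infer_instance⟩)
    (iIndepFun_pi (μ := fun _ : Fin n => gaussianReal 0 v) (X := fun _ => id) (fun _ => aemeasurable_id))
  have h2 := h.isGaussian_map
  have e : (fun ω : Fin n → ℝ => fun i => ω i) = id := rfl
  simpa [e, Measure.map_id] using h2

lemma var_eq {E : Type*} [MeasurableSpace E] (μ : Measure E) [IsProbabilityMeasure μ] (g : E → ℝ)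
    (hg : MemLp g 2 μ) :
    ∫ z, (g z.2 - g z.1)^2 ∂(μ.prod μ) = 2 * Var[g; μ] := by
  rw [variance_eq_sub hg]
  have hi := hg.integrable (by norm_num)
  have hs := hg.integrable_sq
  have e : ∀ z : E × E, (g z.2 - g z.1)^2 = (g z.1)^2 + (g z.2)^2 - 2 * (g z.1 * g z.2) := by
    intro z; ring
  simp_rw [e]
  have i1 : Integrable (fun z : E × E => (g z.1)^2) (μ.prod μ) := hs.comp_fst μ
  have i2 : Integrable (fun z : E × E => (g z.2)^2) (μ.prod μ) := hs.comp_snd μ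
  have i3 : Integrable (fun z : E × E => 2 * (g z.1 * g z.2)) (μ.prod μ) := (hi.mul_prod hi).const_mul 2
  have i12 : Integrable (fun z : E × E => (g z.1)^2 + (g z.2)^2) (μ.prod μ) := i1.add i2
  rw [integral_sub i12 i3, integral_add i1 i2, integral_const_mul, integral_prod_mul,
    integral_fun_fst (fun x => (g x)^2), integral_fun_snd (fun x => (g x)^2)]
  simp
  ring

lemma step_eq {n : ℕ} (v : NNReal) (g : (Fin n → ℝ) → ℝ) (hc : Continuous g) (θ h : ℝ) :
    ∫ z, (g (Real.cos (θ+h) • z.1 + Real.sin (θ+h) • z.2) - g (Real.cos θ • z.1 + Real.sin θ • z.2))^2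
      ∂((Measure.pi fun _ : Fin n => gaussianReal 0 v).prod (Measure.pi fun _ : Fin n => gaussianReal 0 v))
    = ∫ z, (g (Real.cos h • z.1 + Real.sin h • z.2) - g z.1)^2
      ∂((Measure.pi fun _ : Fin n => gaussianReal 0 v).prod (Measure.pi fun _ : Fin n => gaussianReal 0 v)) := by
  have := gauss_pi n v
  set μ := Measure.pi fun _ : Fin n => gaussianReal 0 v with hμ
  have h0 : ∫ x, id x ∂μ = 0 := by
    ext i
    have := eval_integral (μ := μ) (f := id) (fun i => by
      exact integrable_eval (μ := fun _ : Fin n => gaussianReal 0 v) (i := i) IsGaussian.integrable_id) i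
    rw [this]
    simp only [id, hμ]
    rw [integral_eval]; simp
  have hr := IsGaussian.map_rotation_eq_self h0 θ
  conv_rhs => rw [← hr]
  rw [integral_map (by fun_prop) (by
    apply Continuous.aestronglyMeasurable
    fun_prop)]
  congr 1
  ext z
  simp only [ContinuousLinearMap.rotation_apply]
  congr 3
  rw [Real.cos_add, Real.sin_add]
  ext i
  simp
  ring

lemma chain {n : ℕ} (v : NNReal) (g : (Fin n → ℝ) → ℝ) (hc : Continuous g) (B : ℝ)
    (hB : ∀ x, |g x| ≤ B) (N : ℕ) (hN : 0 < N) :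
    2 * Var[g; Measure.pi fun _ : Fin n => gaussianReal 0 v] ≤
    ∫ z, (N * (g (Real.cos (Real.pi/2/N) • z.1 + Real.sin (Real.pi/2/N) • z.2) - g z.1))^2
      ∂((Measure.pi fun _ : Fin n => gaussianReal 0 v).prod (Measure.pi fun _ : Fin n => gaussianReal 0 v)) := by
  have hm : MemLp g 2 (Measure.pi fun _ : Fin n => gaussianReal 0 v) :=
    MemLp.of_bound hc.aestronglyMeasurable B (Eventually.of_forall fun x => hB x)
  rw [← var_eq _ g hm]
  set μ := Measure.pi fun _ : Fin n => gaussianReal 0 v with hμ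
  set h := Real.pi/2/N with hh
  let G : ℕ → ((Fin n → ℝ) × (Fin n → ℝ)) → ℝ := fun j z =>
    g (Real.cos (j * h) • z.1 + Real.sin (j * h) • z.2)
  have hG : ∀ j, Continuous (G j) := fun j => by fun_prop
  have hint : ∀ i j, Integrable (fun z => (G i z - G j z)^2) (μ.prod μ) := by
    intro i j
    refine Integrable.of_bound (Continuous.aestronglyMeasurable (by fun_prop)) ((2*B)^2)
      (Eventually.of_forall fun z => ?_)
    rw [Real.norm_eq_abs, abs_pow]
    refine pow_le_pow_left₀ (abs_nonneg _) ?_ 2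
    refine (abs_sub _ _).trans ?_
    have := hB (Real.cos (i * h) • z.1 + Real.sin (i * h) • z.2)
    have := hB (Real.cos (j * h) • z.1 + Real.sin (j * h) • z.2)
    simp only [G]; linarith
  have hNh : N * h = Real.pi/2 := by rw [hh]; field_simp
  have e : ∀ z : (Fin n → ℝ) × (Fin n → ℝ), g z.2 - g z.1 = G N z - G 0 z := by
    intro z
    simp [G, hNh]
  calc ∫ z, (g z.2 - g z.1)^2 ∂(μ.prod μ) = ∫ z, (G N z - G 0 z)^2 ∂(μ.prod μ) := by simp_rw [e]
    _ ≤ ∫ z, N * ∑ j ∈ Finset.range N, (G (j+1) z - G j z)^2 ∂(μ.prod μ) := by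
      refine integral_mono (hint _ _) ((integrable_finsetSum _ fun j _ => hint _ _).const_mul _) fun z => ?_
      simp only
      rw [← Finset.sum_range_sub (fun j => G j z)]
      have := sq_sum_le_card_mul_sum_sq (s := Finset.range N) (f := fun j => G (j+1) z - G j z)
      simpa using this
    _ = N * ∑ j ∈ Finset.range N, ∫ z, (g (Real.cos h • z.1 + Real.sin h • z.2) - g z.1)^2 ∂(μ.prod μ) := by
      rw [integral_const_mul, integral_finsetSum _ fun j _ => hint _ _]
      congr 1
      refine Finset.sum_congr rfl fun j _ => ?_
      rw [← step_eq v g hc (j*h) h]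
      congr 1
      ext z
      simp only [G]
      push_cast
      rw [add_mul, one_mul]
    _ = _ := by
      simp_rw [mul_pow]
      rw [integral_const_mul]
      simp
      ring

lemma poincare {n : ℕ} (v : NNReal) (hv : v ≠ 0) (g : (Fin n → ℝ) → ℝ) (K B : ℝ) (hK : 0 ≤ K)
    (hg : ∀ x y, |g x - g y| ≤ K * √(∑ i, (x i - y i)^2)) (hB : ∀ x, |g x| ≤ B) :
    2 * Var[g; Measure.pi fun _ : Fin n => gaussianReal 0 v] ≤ (Real.pi/2)^2 * (v * K^2) := by
  have hgn : ∀ x y, |g x - g y| ≤ (K * √n) * ‖x - y‖ := by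
    intro x y
    refine (hg x y).trans ?_
    rw [mul_assoc]
    gcongr
    rw [Real.sqrt_le_left (by positivity), mul_pow, Real.sq_sqrt (by positivity)]
    calc ∑ i, (x i - y i)^2 ≤ ∑ i : Fin n, ‖x - y‖^2 := by
          refine Finset.sum_le_sum fun i _ => ?_
          rw [← sq_abs]
          exact pow_le_pow_left₀ (abs_nonneg _) (norm_le_pi_norm (x - y) i) 2
      _ = _ := by simp
  set c := K * √n with hcdef
  have hc0 : 0 ≤ c := by positivity
  have hL : LipschitzWith c.toNNReal g := by
    refine LipschitzWith.of_dist_le_mul fun x y => ?_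
    rw [Real.coe_toNNReal _ hc0, Real.dist_eq, dist_eq_norm]
    exact hgn x y
  have hc := hL.continuous
  have := gauss_pi n v
  have hdiff : ∀ᵐ x ∂(Measure.pi fun _ : Fin n => gaussianReal 0 v), DifferentiableAt ℝ g x :=
    (pi_ac n v hv).ae_le (hL.ae_differentiableAt (μ := volume))
  have hch := chain v g hc B hB
  have hlin := int_lin (n := n) v
  set μ := Measure.pi fun _ : Fin n => gaussianReal 0 v with hμ
  let F : ℕ → ((Fin n → ℝ) × (Fin n → ℝ)) → ℝ := fun N z =>
    (N * (g (Real.cos (Real.pi/2/N) • z.1 + Real.sin (Real.pi/2/N) • z.2) - g z.1))^2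
  let f : ((Fin n → ℝ) × (Fin n → ℝ)) → ℝ := fun z => (Real.pi/2 * fderiv ℝ g z.1 z.2)^2
  let b : ((Fin n → ℝ) × (Fin n → ℝ)) → ℝ := fun z => (c * (Real.pi/2) * (‖z.1‖ + ‖z.2‖))^2
  have hFm : ∀ N, AEStronglyMeasurable (F N) (μ.prod μ) := fun N =>
    Continuous.aestronglyMeasurable (by fun_prop)
  have hb : Integrable b (μ.prod μ) := by
    have hid : MemLp (fun x : Fin n → ℝ => ‖x‖) 2 μ := (IsGaussian.memLp_two_id (μ := μ)).norm
    have := ((hid.comp_fst μ).add (hid.comp_snd μ)).const_mul (c * (Real.pi/2))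
    exact this.integrable_sq
  have hFb : ∀ N, ∀ᵐ z ∂(μ.prod μ), ‖F N z‖ ≤ b z := by
    intro N
    refine Eventually.of_forall fun z => ?_
    simp only [F, b]
    rw [Real.norm_eq_abs, abs_pow]
    refine pow_le_pow_left₀ (abs_nonneg _) ?_ 2
    rcases Nat.eq_zero_or_pos N with rfl | hN
    · simp; positivity
    set h := Real.pi/2/N with hh
    have hh0 : 0 ≤ h := by positivity
    have hNh : N * h = Real.pi/2 := by rw [hh]; field_simp
    have h1 : |Real.cos h - 1| ≤ h := by
      have := Real.abs_cos_sub_cos_le h 0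
      simpa [abs_of_nonneg hh0] using this
    have h2 : |Real.sin h| ≤ h := by
      simpa [abs_of_nonneg hh0] using Real.abs_sin_le_abs (x := h)
    rw [abs_mul, Nat.abs_cast]
    have h3 := hgn (Real.cos h • z.1 + Real.sin h • z.2) z.1
    have h4 : ‖Real.cos h • z.1 + Real.sin h • z.2 - z.1‖ ≤ h * (‖z.1‖ + ‖z.2‖) := by
      have : Real.cos h • z.1 + Real.sin h • z.2 - z.1 = (Real.cos h - 1) • z.1 + Real.sin h • z.2 := by
        module
      rw [this]
      refine (norm_add_le _ _).trans ?_
      rw [norm_smul, norm_smul, Real.norm_eq_abs, Real.norm_eq_abs, mul_add]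
      gcongr
    calc _ ≤ (N:ℝ) * (c * (h * (‖z.1‖ + ‖z.2‖))) := by
          gcongr
          exact h3.trans (by gcongr)
      _ = c * (N * h) * (‖z.1‖ + ‖z.2‖) := by ring
      _ = _ := by rw [hNh]
  have hlim : ∀ᵐ z ∂(μ.prod μ), Tendsto (fun N => F N z) atTop (𝓝 (f z)) := by
    have hd' : ∀ᵐ z ∂(μ.prod μ), DifferentiableAt ℝ g z.1 :=
      Measure.quasiMeasurePreserving_fst.ae hdiff
    filter_upwards [hd'] with z hz
    refine Tendsto.pow ?_ 2
    have hcurve : HasDerivAt (fun t : ℝ => Real.cos t • z.1 + Real.sin t • z.2) z.2 0 := by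
      have := ((Real.hasDerivAt_cos 0).smul_const z.1).add ((Real.hasDerivAt_sin 0).smul_const z.2)
      simpa using! this
    have hz' : HasFDerivAt g (fderiv ℝ g z.1) (Real.cos 0 • z.1 + Real.sin 0 • z.2) := by
      simpa using hz.hasFDerivAt
    have hcomp := (hz'.comp_hasDerivAt 0 hcurve).tendsto_slope
    have ht : Tendsto (fun N : ℕ => Real.pi/2/(N:ℝ)) atTop (𝓝[≠] 0) := by
      refine tendsto_nhdsWithin_iff.2 ⟨tendsto_const_div_atTop_nhds_zero_nat _, ?_⟩
      filter_upwards [eventually_gt_atTop 0] with N hN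
      have : (0:ℝ) < N := by exact_mod_cast hN
      have : 0 < Real.pi/2/(N:ℝ) := by positivity
      exact this.ne'
    have := (hcomp.comp ht).const_mul (Real.pi/2)
    refine this.congr' ?_
    filter_upwards [eventually_gt_atTop 0] with N hN
    have : (0:ℝ) < N := by exact_mod_cast hN
    simp only [Function.comp, slope_def_field]
    simp only [Real.cos_zero, Real.sin_zero, one_smul, zero_smul, add_zero, sub_zero]
    field_simp
  have hT := tendsto_integral_of_dominated_convergence b hFm hb hFb hlim
  have h1 : 2 * Var[g; μ] ≤ ∫ z, f z ∂(μ.prod μ) := by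
    refine ge_of_tendsto hT ?_
    filter_upwards [eventually_gt_atTop 0] with N hN using hch N hN
  refine h1.trans ?_
  have hfm : AEStronglyMeasurable f (μ.prod μ) := aestronglyMeasurable_of_tendsto_ae atTop hFm hlim
  have hfi : Integrable f (μ.prod μ) := by
    refine hb.mono' hfm ?_
    filter_upwards [hlim, ae_all_iff.2 hFb] with z hz hz2
    exact le_of_tendsto hz.norm (Eventually.of_forall hz2)
  rw [integral_prod f hfi]
  have h2 : ∀ x, ∫ y, f (x, y) ∂μ ≤ (Real.pi/2)^2 * (v * K^2) := by
    intro x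
    simp only [f, mul_pow]
    rw [integral_const_mul, hlin]
    gcongr
    exact grad_bound g K hK hg x
  calc _ ≤ ∫ x, (Real.pi/2)^2 * (v * K^2) ∂μ :=
        integral_mono hfi.integral_prod_left (integrable_const _) h2
    _ = _ := by simp


open scoped Matrix.Norms.L2Operator in
lemma entry_le {m : ℕ} (M : Matrix (Fin m) (Fin m) ℝ) (j : Fin m) : |M j j| ≤ ‖M‖ := by
  have h := M.l2_opNorm_mulVec (EuclideanSpace.single j 1)
  rw [EuclideanSpace.norm_single] at h
  have h2 := PiLp.norm_apply_le ((EuclideanSpace.equiv (Fin m) ℝ).symm <| M *ᵥ (EuclideanSpace.single j (1:ℝ))) j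
  simp at h2 h
  exact h2.trans h

open scoped Matrix.Norms.L2Operator in
lemma trace_diag {m : ℕ} (M : Matrix (Fin m) (Fin m) ℝ) (d : Fin m → ℝ) (s : ℝ)
    (hd : ∑ j, |d j| ≤ s) : |Matrix.trace (M * diagonal d)| ≤ ‖M‖ * s := by
  rw [Matrix.trace]
  simp only [diag_apply, mul_diagonal]
  calc |∑ i, M i i * d i| ≤ ∑ i, |M i i * d i| := Finset.abs_sum_le_sum_abs _ _
    _ ≤ ∑ i, ‖M‖ * |d i| := by
      refine Finset.sum_le_sum fun i _ => ?_
      rw [abs_mul]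
      exact mul_le_mul_of_nonneg_right (entry_le M i) (abs_nonneg _)
    _ = ‖M‖ * ∑ i, |d i| := by rw [Finset.mul_sum]
    _ ≤ _ := by gcongr

open scoped Matrix.Norms.L2Operator in
lemma opnorm_one_le {m : ℕ} : ‖(1 : Matrix (Fin m) (Fin m) ℝ)‖ ≤ 1 := by
  rw [← diagonal_one, l2_opNorm_diagonal]
  exact (pi_norm_le_iff_of_nonneg zero_le_one).2 (by simp)

open scoped Matrix.Norms.L2Operator in
lemma psi_le {m n : ℕ} (A : Matrix (Fin m) (Fin n) ℝ) 
    (hA : ∀ x : Fin n → ℝ, ∑ i, (A.mulVec x i) ^ 2 ≤ ∑ j, x j ^ 2) (κ : ℝ) (h0 : 0 ≤ κ) (h1 : κ ≤ 1) :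
    ‖A * Aᵀ - κ • 1‖ ≤ 2 := by
  have hA1 : ‖A‖ ≤ 1 := by
    rw [l2_opNorm_def]
    refine ContinuousLinearMap.opNorm_le_bound _ zero_le_one fun x => ?_
    rw [one_mul, EuclideanSpace.norm_eq, EuclideanSpace.norm_eq]
    refine Real.sqrt_le_sqrt ?_
    simpa using hA x
  have hA2 : ‖Aᵀ‖ ≤ 1 := by
    rw [← conjTranspose_eq_transpose_of_trivial, l2_opNorm_conjTranspose]; exact hA1
  calc ‖A * Aᵀ - κ • 1‖ ≤ ‖A * Aᵀ‖ + ‖κ • (1 : Matrix (Fin m) (Fin m) ℝ)‖ := norm_sub_le _ _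
    _ ≤ 1 * 1 + 1 * 1 := by
      gcongr
      · refine (l2_opNorm_mul _ _).trans ?_
        gcongr
      · rw [norm_smul, Real.norm_eq_abs, abs_of_nonneg h0]
        gcongr
        exact opnorm_one_le
    _ = 2 := by norm_num

open scoped Matrix.Norms.L2Operator in
lemma prod_le {m : ℕ} (P : Matrix (Fin m) (Fin m) ℝ) (hP : ‖P‖ ≤ 2) (Q : ℝ) (hQ : 1 ≤ Q) (k : ℕ)
    (d : Fin k → Fin m → ℝ) (hd : ∀ i j, |d i j| ≤ Q) :
    ‖(List.ofFn fun i : Fin k => P * diagonal (d i)).prod‖ ≤ (2*Q)^k := by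
  induction k with
  | zero => simpa using opnorm_one_le
  | succ k ih =>
    rw [List.ofFn_succ, List.prod_cons, pow_succ']
    refine (l2_opNorm_mul _ _).trans ?_
    gcongr
    · refine (l2_opNorm_mul _ _).trans ?_
      gcongr
      rw [l2_opNorm_diagonal]
      exact (pi_norm_le_iff_of_nonneg (by linarith)).2 (hd 0)
    · exact ih _ fun i => hd i.succ

open scoped Matrix.Norms.L2Operator in
lemma tr_lip {m : ℕ} (P : Matrix (Fin m) (Fin m) ℝ) (hP : ‖P‖ ≤ 2) (Q : ℝ) (hQ : 1 ≤ Q) (s : ℝ) (hs : 0 ≤ s) (k : ℕ)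
    (d d' : Fin k → Fin m → ℝ) (hd : ∀ i j, |d i j| ≤ Q) (hd' : ∀ i j, |d' i j| ≤ Q)
    (hdd : ∀ i, ∑ j, |d i j - d' i j| ≤ s) (N : Matrix (Fin m) (Fin m) ℝ) :
    |Matrix.trace (N * ((List.ofFn fun i : Fin k => P * diagonal (d i)).prod
      - (List.ofFn fun i : Fin k => P * diagonal (d' i)).prod))| ≤ ‖N‖ * (k * (2*Q)^k * s) := by
  induction k generalizing N with
  | zero => simp
  | succ k ih =>
    simp only [List.ofFn_succ, List.prod_cons]
    have b1 := prod_le P hP Q hQ k (fun i => d i.succ) (fun i => hd i.succ)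
    have b2 := ih (fun i => d i.succ) (fun i => d' i.succ) (fun i => hd i.succ) (fun i => hd' i.succ)
      (fun i => hdd i.succ) (N * (P * diagonal (d' 0)))
    set R := (List.ofFn fun i : Fin k => P * diagonal (d i.succ)).prod
    set R' := (List.ofFn fun i : Fin k => P * diagonal (d' i.succ)).prod
    have e : N * (P * diagonal (d 0) * R - P * diagonal (d' 0) * R')
      = N * P * (diagonal (fun j => d 0 j - d' 0 j)) * R + N * (P * diagonal (d' 0)) * (R - R') := by
      rw [← diagonal_sub]
      noncomm_ring
    rw [e, trace_add, trace_mul_comm, ← mul_assoc]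
    have b3 := trace_diag (R * (N * P)) _ s (hdd 0)
    have b4 : ‖R * (N * P)‖ ≤ (2*Q)^k * (‖N‖ * 2) :=
      (l2_opNorm_mul _ _).trans (mul_le_mul b1 ((l2_opNorm_mul _ _).trans (by gcongr)) (norm_nonneg _) (by positivity))
    have b5 : ‖N * (P * diagonal (d' 0))‖ ≤ ‖N‖ * (2 * Q) := by
      refine (l2_opNorm_mul _ _).trans ?_
      gcongr
      refine (l2_opNorm_mul _ _).trans ?_
      gcongr
      rw [l2_opNorm_diagonal]
      exact (pi_norm_le_iff_of_nonneg (by linarith)).2 (hd' 0)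
    calc _ ≤ (2*Q)^k * (‖N‖ * 2) * s + ‖N‖ * (2 * Q) * (k * (2*Q)^k * s) :=
          (abs_add_le _ _).trans (add_le_add (b3.trans (by gcongr)) (b2.trans (by gcongr)))
      _ ≤ (2*Q)^k * (‖N‖ * (2*Q)) * s + ‖N‖ * (2 * Q) * (k * (2*Q)^k * s) := by
          gcongr; linarith
      _ = _ := by push_cast; ring

end

/-- Variance bound for the normalized trace of an alternating product along a Gaussian
signal (consequence of the Gaussian Poincaré inequality): for `x ∼ N(0, I_n/κ)`,
`A` an `m×n` matrix with `‖A‖_op ≤ 1`, `Ψ = A Aᵀ - κ I`, and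
`f(x) = Tr(∏_i Ψ q_i(diag(A x)))/m` with the `q_i` bounded and Lipschitz, one has
`Var f(x) ≤ C²/(κ m)` where `C` depends only on `k`, the sup-norm bound `Q` and the
Lipschitz constant `L`. -/
theorem stmt9 (k : ℕ) (Q : ℝ) (L : NNReal) :
    ∃ C : ℝ, 0 ≤ C ∧
      ∀ (m n : ℕ) (κ : NNReal), 0 < κ → (κ : ℝ) < 1 →
      ∀ A : Matrix (Fin m) (Fin n) ℝ,
        (∀ x : Fin n → ℝ, ∑ i, (A.mulVec x i) ^ 2 ≤ ∑ j, x j ^ 2) →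
      ∀ q : Fin k → ℝ → ℝ,
        (∀ i x, |q i x| ≤ Q) →
        (∀ i, LipschitzWith L (q i)) →
        ProbabilityTheory.variance
          (fun x : Fin n → ℝ =>
            Matrix.trace ((List.ofFn fun i : Fin k =>
              (A * Aᵀ - (κ : ℝ) • 1) * Matrix.diagonal fun j => q i (A.mulVec x j)).prod) / m)
          (Measure.pi fun _ : Fin n => gaussianReal 0 κ⁻¹)
        ≤ C ^ 2 / (κ * m) := by
  set Q' := max Q 1 with hQ'
  have hQ1 : 1 ≤ Q' := le_max_right _ _
  set D : ℝ := k * (2 * Q')^k * L with hD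
  have hD0 : 0 ≤ D := by positivity
  refine ⟨Real.pi / 2 * D, by positivity, ?_⟩
  intro m n κ hκ hκ1 A hA q hq hqL
  have hP := psi_le A hA κ κ.2 hκ1.le
  set P := A * Aᵀ - (κ : ℝ) • (1 : Matrix (Fin m) (Fin m) ℝ) with hPdef
  have hqQ : ∀ i x, |q i x| ≤ Q' := fun i x => (hq i x).trans (le_max_left _ _)
  set g : (Fin n → ℝ) → ℝ := fun x => Matrix.trace ((List.ofFn fun i : Fin k =>
              P * Matrix.diagonal fun j => q i (A.mulVec x j)).prod) / m with hg
  have hB : ∀ x, |g x| ≤ (2 * Q')^k * m / m := by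
    intro x
    simp only [hg]
    rw [abs_div, Nat.abs_cast]
    gcongr
    have h1 := prod_le P hP Q' hQ1 k (fun i j => q i (A.mulVec x j)) (fun i j => hqQ _ _)
    have h2 := trace_diag ((List.ofFn fun i : Fin k =>
              P * Matrix.diagonal fun j => q i (A.mulVec x j)).prod) (fun _ => 1) m (by simp)
    rw [diagonal_one, mul_one] at h2
    exact h2.trans (by gcongr)
  have hK : ∀ x y, |g x - g y| ≤ (D * √m / m) * √(∑ i, (x i - y i)^2) := by
    intro x y
    set r := √(∑ i, (x i - y i)^2) with hr
    have hs : ∀ i, ∑ j, |q i (A.mulVec x j) - q i (A.mulVec y j)| ≤ L * (√m * r) := by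
      intro i
      have a1 : ∀ j, |q i (A.mulVec x j) - q i (A.mulVec y j)| ≤ L * |A.mulVec (x - y) j| := by
        intro j
        have := (hqL i).dist_le_mul (A.mulVec x j) (A.mulVec y j)
        rw [Real.dist_eq, Real.dist_eq] at this
        rwa [mulVec_sub]
      refine (Finset.sum_le_sum fun j _ => a1 j).trans ?_
      rw [← Finset.mul_sum]
      gcongr
      rw [hr, ← Real.sqrt_mul (by positivity)]
      refine Real.le_sqrt_of_sq_le ?_
      have a2 := sq_sum_le_card_mul_sum_sq (s := Finset.univ) (f := fun j => |A.mulVec (x - y) j|)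
      simp only [sq_abs, Finset.card_univ, Fintype.card_fin] at a2
      refine a2.trans ?_
      gcongr
      exact hA (x - y)
    have h1 := tr_lip P hP Q' hQ1 (L * (√m * r)) (by positivity) k
      (fun i j => q i (A.mulVec x j)) (fun i j => q i (A.mulVec y j))
      (fun i j => hqQ _ _) (fun i j => hqQ _ _) hs 1
    rw [one_mul, trace_sub] at h1
    have h2 := h1.trans (mul_le_mul_of_nonneg_right opnorm_one_le (by positivity))
    simp only [hg]
    rw [← sub_div, abs_div, Nat.abs_cast]
    calc _ ≤ 1 * (k * (2 * Q')^k * (L * (√m * r))) / (m : ℝ) := by gcongr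
      _ = _ := by rw [hD]; ring
  have hp := poincare κ⁻¹ (inv_ne_zero hκ.ne') g _ _ (by positivity) hK hB
  have hm : (D * √m / m)^2 = D^2 / m := by
    rw [div_pow, mul_pow, Real.sq_sqrt (by positivity)]
    rcases Nat.eq_zero_or_pos m with h | h
    · simp [h]
    · have : (0:ℝ) < m := by exact_mod_cast h
      field_simp
  have e : (Real.pi / 2 * D)^2 / (κ * m) = (Real.pi/2)^2 * ((κ⁻¹ : NNReal) * (D * √m / m)^2) := by
    rw [hm, NNReal.coe_inv, mul_pow, div_eq_mul_inv, mul_inv]; ring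
  rw [e]
  have := variance_nonneg g (Measure.pi fun _ : Fin n => gaussianReal 0 κ⁻¹)
  linarith
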